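/- Let G be a weak near-triangulation and let X ⊆ V(G) be a set such that G−X is a weak near-triangulation. Suppose uvw is a triangle of G, let Y be the set of vertices of G contained in the interior of the triangle uvw, and suppose X ∩ Y = ∅, u ∈ X, and v, w ∉ X. If y ∈ Y is a problematic vertex in G−X, then every y-bad vertex in G−X is adjacent to u in G. -/

import Mathlib

open Set

/-- A plane graph: a finite simple graph whose vertices are points of the plane,
together with a plane embedding in which every edge is drawn as an arc (the range of an
injective path) joining its endpoints, two arcs meet only in common endpoints, and
no vertex lies on an arc other than at its endpoints. -/
structure PlaneGraph where
  verts : Set (ℝ × ℝ)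
  finite_verts : verts.Finite
  Adj : (ℝ × ℝ) → (ℝ × ℝ) → Prop
  adj_symm : ∀ u v, Adj u v → Adj v u
  adj_irrefl : ∀ v, ¬ Adj v v
  adj_mem : ∀ u v, Adj u v → u ∈ verts
  arc : (ℝ × ℝ) → (ℝ × ℝ) → Set (ℝ × ℝ)
  arc_symm : ∀ u v, arc u v = arc v u
  arc_path : ∀ u v, Adj u v → ∃ γ : Path u v, Function.Injective ⇑γ ∧ arc u v = Set.range ⇑γ
  arc_verts : ∀ u v, Adj u v → verts ∩ arc u v ⊆ {u, v}
  arc_inter : ∀ u v u' v', Adj u v → Adj u' v' → ({u, v} : Set (ℝ × ℝ)) ≠ {u', v'} →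
    arc u v ∩ arc u' v' ⊆ ({u, v} : Set (ℝ × ℝ)) ∩ {u', v'}

namespace PlaneGraph

/-- The plane subgraph induced on a set of vertices, with the inherited embedding. -/
def induce (G : PlaneGraph) (S : Set (ℝ × ℝ)) : PlaneGraph where
  verts := G.verts ∩ S
  finite_verts := G.finite_verts.subset inter_subset_left
  Adj u v := G.Adj u v ∧ u ∈ S ∧ v ∈ S
  adj_symm _ _ h := ⟨G.adj_symm _ _ h.1, h.2.2, h.2.1⟩
  adj_irrefl v h := G.adj_irrefl v h.1
  adj_mem _ _ h := ⟨G.adj_mem _ _ h.1, h.2.1⟩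
  arc := G.arc
  arc_symm := G.arc_symm
  arc_path _ _ h := G.arc_path _ _ h.1
  arc_verts _ _ h := fun _ hx => G.arc_verts _ _ h.1 ⟨hx.1.1, hx.2⟩
  arc_inter _ _ _ _ h h' hne := G.arc_inter _ _ _ _ h.1 h'.1 hne

/-- Deleting a set of vertices (together with all incident edges),
keeping the inherited embedding. -/
def delete (G : PlaneGraph) (X : Set (ℝ × ℝ)) : PlaneGraph := G.induce Xᶜ

/-- Deleting a single vertex. -/
def erase (G : PlaneGraph) (x : ℝ × ℝ) : PlaneGraph := G.delete {x}

/-- The point set of the plane drawing of `G`. -/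
def drawing (G : PlaneGraph) : Set (ℝ × ℝ) :=
  G.verts ∪ ⋃ (u) (v) (_ : G.Adj u v), G.arc u v

/-- The faces of `G`: connected components of the complement of the drawing. -/
def IsFace (G : PlaneGraph) (F : Set (ℝ × ℝ)) : Prop :=
  ∃ x, x ∉ G.drawing ∧ F = connectedComponentIn G.drawingᶜ x

/-- A vertex is external if it is incident to (i.e. lies on the boundary of)
an unbounded face. -/
def ExternalVertex (G : PlaneGraph) (v : ℝ × ℝ) : Prop :=
  v ∈ G.verts ∧ ∃ F, G.IsFace F ∧ ¬ Bornology.IsBounded F ∧ v ∈ closure F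

/-- A triangle (cycle on three vertices) of `G`. -/
def IsTriangle (G : PlaneGraph) (a b c : ℝ × ℝ) : Prop :=
  a ≠ b ∧ a ≠ c ∧ b ≠ c ∧ G.Adj a b ∧ G.Adj b c ∧ G.Adj a c

/-- `v` is contained in a triangle of `G`. -/
def InTriangle (G : PlaneGraph) (v : ℝ × ℝ) : Prop := ∃ b c, G.IsTriangle v b c

/-- The drawing of the closed curve formed by a triangle on `a`, `b`, `c`. -/
def triDrawing (G : PlaneGraph) (a b c : ℝ × ℝ) : Set (ℝ × ℝ) :=
  G.arc a b ∪ G.arc b c ∪ G.arc a c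

/-- A face is triangular if its boundary is the drawing of a triangle of `G`. -/
def IsTriangularFace (G : PlaneGraph) (F : Set (ℝ × ℝ)) : Prop :=
  ∃ a b c, G.IsTriangle a b c ∧ frontier F = G.triDrawing a b c

/-- The interior region of the closed curve drawn by a triangle: the union of the
bounded connected components of the complement of its drawing. -/
def triangleInterior (G : PlaneGraph) (a b c : ℝ × ℝ) : Set (ℝ × ℝ) :=
  {x | x ∉ G.triDrawing a b c ∧
    Bornology.IsBounded (connectedComponentIn (G.triDrawing a b c)ᶜ x)}

/-- A facial triangle: a triangle whose interior region is a face of `G`. -/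
def IsFacialTriangle (G : PlaneGraph) (a b c : ℝ × ℝ) : Prop :=
  G.IsTriangle a b c ∧ G.IsFace (G.triangleInterior a b c)

/-- A weak near-triangulation: every bounded face is triangular and every vertex
is contained in a triangle. -/
def IsWNT (G : PlaneGraph) : Prop :=
  (∀ F, G.IsFace F → Bornology.IsBounded F → G.IsTriangularFace F) ∧
  ∀ v ∈ G.verts, G.InTriangle v

/-- Reachability by walks in `G`. -/
def Reachable (G : PlaneGraph) (u v : ℝ × ℝ) : Prop := Relation.ReflTransGen G.Adj u v

/-- Connectedness of `G`. -/
def Connected (G : PlaneGraph) : Prop :=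
  G.verts.Nonempty ∧ ∀ u ∈ G.verts, ∀ v ∈ G.verts, G.Reachable u v

/-- A cutvertex: a vertex whose deletion separates two other vertices. -/
def IsCutvertex (G : PlaneGraph) (v : ℝ × ℝ) : Prop :=
  v ∈ G.verts ∧ ∃ a b, a ∈ G.verts ∧ b ∈ G.verts ∧ a ≠ v ∧ b ≠ v ∧
    G.Reachable a b ∧ ¬ (G.erase v).Reachable a b

/-- 2-connectivity: connected, on at least three vertices, with no cutvertex. -/
def TwoConnected (G : PlaneGraph) : Prop :=
  G.Connected ∧ 3 ≤ G.verts.ncard ∧ ∀ v, ¬ G.IsCutvertex v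

/-- A near-triangulation: a 2-connected plane graph all of whose bounded faces
are triangular. -/
def IsNearTriangulation (G : PlaneGraph) : Prop :=
  G.TwoConnected ∧ ∀ F, G.IsFace F → Bornology.IsBounded F → G.IsTriangularFace F

/-- A plane triangulation: a connected plane graph all of whose faces (including
the unbounded one) are triangular. -/
def IsTriangulation (G : PlaneGraph) : Prop :=
  G.Connected ∧ ∀ F, G.IsFace F → G.IsTriangularFace F

/-- A block of `G`, given by its vertex set `B`: a maximal set of vertices inducing
a connected subgraph without a cutvertex. -/
def IsBlock (G : PlaneGraph) (B : Set (ℝ × ℝ)) : Prop :=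
  B ⊆ G.verts ∧ (G.induce B).Connected ∧ (∀ v, ¬ (G.induce B).IsCutvertex v) ∧
  ∀ B', B ⊆ B' → B' ⊆ G.verts → (G.induce B').Connected →
    (∀ v, ¬ (G.induce B').IsCutvertex v) → B' = B

/-- A plane graph is outerplanar if all of its vertices are incident to the
unbounded face. -/
def IsOuterplanar (G : PlaneGraph) : Prop := ∀ v ∈ G.verts, G.ExternalVertex v

/-- A dominating set of `G`. -/
def IsDominatingSet (G : PlaneGraph) (D : Set (ℝ × ℝ)) : Prop :=
  D ⊆ G.verts ∧ ∀ v ∈ G.verts, v ∉ D → ∃ d ∈ D, G.Adj v d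

/-- The domination number of `G`. -/
noncomputable def dominationNumber (G : PlaneGraph) : ℕ :=
  sInf {n | ∃ D, G.IsDominatingSet D ∧ D.ncard = n}

/-- `u` is problematic in `G` if `G − u` is not a weak near-triangulation. -/
def Problematic (G : PlaneGraph) (u : ℝ × ℝ) : Prop := ¬ (G.erase u).IsWNT

/-- `x` is a `u`-bad vertex in `G`: a vertex of `G − u` not contained in a triangle
of `G − u`. -/
def IsBadFor (G : PlaneGraph) (u x : ℝ × ℝ) : Prop :=
  x ∈ G.verts ∧ x ≠ u ∧ ¬ (G.erase u).InTriangle x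

end PlaneGraph


/-- The standard identification of the plane with `ℂ`. -/
noncomputable def planeCoord (z : ℝ × ℝ) : ℂ := Complex.equivRealProdCLM.symm z

lemma continuous_planeCoord : Continuous planeCoord :=
  Complex.equivRealProdCLM.symm.continuous

lemma planeCoord_sub_ne_zero {z p : ℝ × ℝ} (h : z ≠ p) : planeCoord z - planeCoord p ≠ 0 :=
  sub_ne_zero.2 fun he => h (Complex.equivRealProdCLM.symm.injective he)

/-- `h` is a continuous branch of the logarithm of `f` on `S`. -/
def IsLogOn (f h : ℝ × ℝ → ℂ) (S : Set (ℝ × ℝ)) : Prop :=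
  ContinuousOn h S ∧ ∀ z ∈ S, Complex.exp (h z) = f z

lemma IsLogOn.mono {f h : ℝ × ℝ → ℂ} {S T : Set (ℝ × ℝ)} (hf : IsLogOn f h S) (hT : T ⊆ S) :
    IsLogOn f h T :=
  ⟨hf.1.mono hT, fun z hz => hf.2 z (hT hz)⟩

lemma IsLogOn.zpow {f h : ℝ × ℝ → ℂ} {S : Set (ℝ × ℝ)} (hf : IsLogOn f h S) (n : ℤ) :
    IsLogOn (fun z => f z ^ n) (fun z => n * h z) S :=
  ⟨continuousOn_const.mul hf.1, fun z hz => by rw [Complex.exp_int_mul, hf.2 z hz]⟩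

lemma IsLogOn.mul {f g h k : ℝ × ℝ → ℂ} {S : Set (ℝ × ℝ)} (hf : IsLogOn f h S)
    (hg : IsLogOn g k S) : IsLogOn (fun z => f z * g z) (fun z => h z + k z) S :=
  ⟨hf.1.add hg.1, fun z hz => by rw [Complex.exp_add, hf.2 z hz, hg.2 z hz]⟩

lemma IsLogOn.union {f h k : ℝ × ℝ → ℂ} {A B : Set (ℝ × ℝ)} (hA : IsClosed A) (hB : IsClosed B)
    (hf : IsLogOn f h A) (hg : IsLogOn f k B) (heq : EqOn h k (A ∩ B)) :
    ∃ l, IsLogOn f l (A ∪ B) := by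
  classical
  have e1 : EqOn (A.piecewise h k) h A := fun z hz => by simp [hz]
  have e2 : EqOn (A.piecewise h k) k B := fun z hz => by
    by_cases h' : z ∈ A
    · simp [h', heq ⟨h', hz⟩]
    · simp [h']
  refine ⟨A.piecewise h k, ((hf.1.congr e1).union_of_isClosed (hg.1.congr e2) hA hB), ?_⟩
  rintro z (hz | hz)
  · rw [e1 hz, hf.2 z hz]
  · rw [e2 hz, hg.2 z hz]

/-- A branch of the logarithm can be normalised at a point. -/
lemma IsLogOn.exists_eq_at {f h k : ℝ × ℝ → ℂ} {A B : Set (ℝ × ℝ)} {x : ℝ × ℝ}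
    (hf : IsLogOn f h A) (hg : IsLogOn f k B) (hx : x ∈ A ∩ B) :
    ∃ k', IsLogOn f k' B ∧ k' x = h x := by
  refine ⟨fun z => k z + (h x - k x), ⟨hg.1.add continuousOn_const, fun z hz => ?_⟩, by ring⟩
  rw [Complex.exp_add, Complex.exp_sub, hf.2 x hx.1, hg.2 x hx.2, hg.2 z hz, div_self, mul_one]
  rw [← hg.2 x hx.2]; exact Complex.exp_ne_zero _

/-- Every nonvanishing continuous function on an arc has a continuous logarithm. -/
lemma exists_isLogOn_range_path {a b : ℝ × ℝ} (γ : Path a b) (hγ : Function.Injective γ)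
    {f : ℝ × ℝ → ℂ} (hf : ContinuousOn f (range γ)) (h0 : ∀ z ∈ range γ, f z ≠ 0) :
    ∃ h, IsLogOn f h (range γ) := by
  have hemb : Topology.IsClosedEmbedding γ := γ.continuous.isClosedEmbedding hγ
  let π : ℝ → unitInterval := projIcc 0 1 zero_le_one
  have hπ : Continuous π := continuous_projIcc
  let F : C(ℝ, ℂ) := ⟨fun t => f (γ (π t)),
    hf.comp_continuous (γ.continuous.comp hπ) fun t => mem_range_self (π t)⟩
  obtain ⟨L, ⟨-, hL⟩, -⟩ := Complex.isCoveringMapOn_exp.existsUnique_continuousMap_lifts F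
    (a₀ := 0) (e₀ := Complex.log (F 0)) (Complex.exp_log (h0 _ (mem_range_self _)))
    (fun t => h0 _ (mem_range_self (π t)))
  obtain ⟨g, hg⟩ := ContinuousMap.exists_extension' hemb
    (L.comp ⟨Subtype.val, continuous_subtype_val⟩)
  refine ⟨g, g.continuous.continuousOn, ?_⟩
  rintro _ ⟨t, rfl⟩
  have h1 : g (γ t) = L t := congrFun hg t
  have h2 : Complex.exp (L t) = f (γ (π t)) := congrFun hL t
  rw [h1, h2, show π t = t from projIcc_val _ t]

lemma exists_isLogOn_plane {f : ℝ × ℝ → ℂ} (hf : Continuous f) (h0 : ∀ z, f z ≠ 0) :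
    ∃ h, IsLogOn f h univ := by
  let F : C(ℝ × ℝ, ℂ) := ⟨_, hf⟩
  obtain ⟨L, ⟨-, hL⟩, -⟩ := Complex.isCoveringMapOn_exp.existsUnique_continuousMap_lifts F
    (a₀ := 0) (e₀ := Complex.log (F 0)) (Complex.exp_log (h0 _)) h0
  exact ⟨L, L.continuous.continuousOn, fun z _ => congrFun hL z⟩

/-- A nonzero power of `z - p` has no continuous logarithm defined near infinity. -/
lemma eq_zero_of_isLogOn_plane {f h : ℝ × ℝ → ℂ} {U : Set (ℝ × ℝ)} {p : ℝ × ℝ} {m : ℤ}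
    (hU : Bornology.IsBounded U) (hf : IsLogOn f h univ)
    (hfU : ∀ z ∉ U, f z = (planeCoord z - planeCoord p) ^ m) : m = 0 := by
  have hU' : Bornology.IsBounded ((fun z => planeCoord z - planeCoord p) '' closure U) := by
    have hK : IsCompact (closure U) := Metric.isCompact_of_isClosed_isBounded isClosed_closure
      hU.closure
    exact (hK.image (continuous_planeCoord.sub continuous_const)).isBounded
  obtain ⟨R, hR⟩ := hU'.subset_closedBall 0
  set r : ℝ := max R 0 + 1
  have hrpos : 0 < r := by positivity
  let c : ℝ → ℝ × ℝ := fun t =>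
    Complex.equivRealProdCLM (planeCoord p + Complex.exp (Real.log r + t * Complex.I))
  have hc : Continuous c := by fun_prop
  have hcc : ∀ t, planeCoord (c t) - planeCoord p = Complex.exp (Real.log r + t * Complex.I) := by
    intro t
    simp only [c, planeCoord, ContinuousLinearEquiv.symm_apply_apply, add_sub_cancel_left]
  have hcU : ∀ t, c t ∉ U := by
    intro t ht
    have := hR (mem_image_of_mem _ (subset_closure ht))
    simp only [hcc, mem_closedBall_zero_iff, Complex.norm_exp] at this
    simp [Real.exp_log hrpos] at this
    linarith [le_max_left R 0]
  let l : ℝ → ℂ := fun t => h (c t) - m * (Real.log r + t * Complex.I)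
  have hl : Continuous l := by
    have : Continuous h := continuousOn_univ.1 hf.1
    fun_prop
  have hl1 : ∀ t, Complex.exp (l t) = 1 := by
    intro t
    simp only [l]
    rw [Complex.exp_sub, hf.2 _ (mem_univ _), hfU _ (hcU t), hcc, ← Complex.exp_int_mul, div_self
      (Complex.exp_ne_zero _)]
  have hconst : l 0 = l (2 * Real.pi) := by
    have hcov := Complex.isCoveringMap_exp
    have := hcov.eq_of_comp_eq (A := ℝ) (g₁ := l) (g₂ := fun _ => l 0) hl continuous_const
      (by funext t; simp [hl1]) 0 rfl
    exact (congrFun this _).symm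
  have hper : c 0 = c (2 * Real.pi) := by
    simp only [c, Complex.exp_add]
    simp [Complex.exp_two_pi_mul_I]
  simp only [l, hper] at hconst
  have : (m : ℂ) * (2 * Real.pi * Complex.I) = 0 := by
    push_cast at hconst
    linear_combination hconst
  simpa [Complex.I_ne_zero, Real.pi_ne_zero] using this

/-- The essential part of Eilenberg's separation criterion. -/
lemma eq_zero_of_isLogOn_frontier {U : Set (ℝ × ℝ)} (hU : IsOpen U) (hUb : Bornology.IsBounded U)
    {p : ℝ × ℝ} (hp : p ∈ U) {g h : ℝ × ℝ → ℂ} {m : ℤ} (hg : ContinuousOn g (closure U))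
    (hg0 : ∀ z ∈ closure U, g z ≠ 0)
    (hh : IsLogOn (fun z => (planeCoord z - planeCoord p) ^ m * g z) h (frontier U)) : m = 0 := by
  classical
  obtain ⟨H, hH⟩ := ContinuousMap.exists_restrict_eq isClosed_frontier
    ⟨_, continuousOn_iff_continuous_domRestrict.1 hh.1⟩
  have hH' : ∀ z ∈ frontier U, Complex.exp (H z) = (planeCoord z - planeCoord p) ^ m * g z := by
    intro z hz
    have := congrArg (fun k => k ⟨z, hz⟩) hH
    simp only [ContinuousMap.restrict_apply, ContinuousMap.coe_mk, domRestrict_apply] at this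
    rw [this]
    exact hh.2 z hz
  let φ : ℝ × ℝ → ℂ := fun z =>
    if z ∈ U then Complex.exp (H z) / g z else (planeCoord z - planeCoord p) ^ m
  have hne : ∀ z ∉ U, planeCoord z - planeCoord p ≠ 0 := fun z hz =>
    planeCoord_sub_ne_zero fun h => hz (h ▸ hp)
  have hφ : Continuous φ := by
    rw [← continuousOn_univ]
    apply ContinuousOn.if
    · intro z hz
      have hz' : z ∈ frontier U := hz.2
      rw [hH' z hz', mul_div_assoc, div_self (hg0 z (frontier_subset_closure hz')), mul_one]
    · rw [univ_inter]
      exact ContinuousOn.div (by fun_prop) hg hg0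
    · have : closure {a | a ∉ U} = Uᶜ := hU.isClosed_compl.closure_eq
      rw [univ_inter, this]
      refine ContinuousOn.zpow₀ ?_ m fun z hz => Or.inl (hne z hz)
      exact (continuous_planeCoord.sub continuous_const).continuousOn
  obtain ⟨L, hL⟩ := exists_isLogOn_plane hφ fun z => by
    by_cases hz : z ∈ U
    · simp [φ, hz, hg0 z (subset_closure hz)]
    · simp only [φ, hz, if_false]; exact zpow_ne_zero _ (hne z hz)
  exact eq_zero_of_isLogOn_plane (p := p) hUb hL fun z hz => by simp [φ, hz]

lemma interior_range_path_eq_empty {a b : ℝ × ℝ} (γ : Path a b) (hγ : Function.Injective γ) :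
    interior (range γ) = ∅ := by
  by_contra hne
  obtain ⟨p, hp⟩ := nonempty_iff_ne_empty.2 hne
  obtain ⟨r, hr, hball⟩ := Metric.isOpen_iff.1 isOpen_interior p hp
  have hball := hball.trans interior_subset
  have hemb : Topology.IsClosedEmbedding γ := γ.continuous.isClosedEmbedding hγ
  let e : unitInterval ≃ₜ range γ := hemb.isEmbedding.toHomeomorph
  let φ := OpenPartialHomeomorph.univBall p r
  have hmem : ∀ z, φ z ∈ range γ := fun z => hball <| by
    have := φ.map_source (x := z) (by simp [φ])
    rwa [OpenPartialHomeomorph.univBall_target p hr] at this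
  let σ : ℝ × ℝ → ℝ := fun z => (e.symm ⟨φ z, hmem z⟩ : unitInterval)
  have hσ : Continuous σ := by
    refine continuous_subtype_val.comp (e.symm.continuous.comp ?_)
    exact (OpenPartialHomeomorph.continuous_univBall p r).subtype_mk _
  have hinj : Function.Injective σ := by
    intro z w hzw
    have h1 := e.symm.injective (Subtype.ext hzw)
    have h2 : φ z = φ w := congrArg Subtype.val h1
    exact φ.injOn (by simp [φ]) (by simp [φ]) h2
  have hrank : 1 < Module.rank ℝ (ℝ × ℝ) := by
    simp [← Module.finrank_eq_rank]
  have key : ∀ x y z, σ x < σ y → σ y < σ z → False := by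
    intro x y z hxy hyz
    have hconn := ((isConnected_compl_singleton_of_one_lt_rank hrank y).image σ
      hσ.continuousOn).isPreconnected.ordConnected
    have hx : σ x ∈ σ '' {y}ᶜ := mem_image_of_mem _ fun h => by
      rw [mem_singleton_iff] at h; exact hxy.ne (by rw [h])
    have hz : σ z ∈ σ '' {y}ᶜ := mem_image_of_mem _ fun h => by
      rw [mem_singleton_iff] at h; exact hyz.ne (by rw [h])
    obtain ⟨w, hw, hwy⟩ := hconn.out hx hz ⟨hxy.le, hyz.le⟩
    exact hw (hinj hwy)
  have h1 : σ (0, 0) ≠ σ (1, 0) := fun h => by simpa using hinj h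
  have h2 : σ (0, 0) ≠ σ (0, 1) := fun h => by simpa using hinj h
  have h3 : σ (1, 0) ≠ σ (0, 1) := fun h => by simpa using hinj h
  rcases lt_or_gt_of_ne h1 with h1 | h1 <;> rcases lt_or_gt_of_ne h2 with h2 | h2 <;>
    rcases lt_or_gt_of_ne h3 with h3 | h3
  all_goals first
    | exact key _ _ _ h1 h3
    | exact key _ _ _ h2 h3
    | exact key _ _ _ h1 h2
    | exact key _ _ _ h2 h1
    | exact key _ _ _ h3 h1
    | exact key _ _ _ h3 h2

/-- Logarithms of `f` on two closed sets sharing exactly the points `x` and `y` can be chosen to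
agree at `x` and to differ at `y` by an integer multiple of `2πi`. -/
lemma exists_isLogOn_gap {f : ℝ × ℝ → ℂ} {A B : Set (ℝ × ℝ)} {x y : ℝ × ℝ}
    (hx : x ∈ A ∩ B) (hy : y ∈ A ∩ B) (hA : ∃ h, IsLogOn f h A) (hB : ∃ h, IsLogOn f h B) :
    ∃ (h k : ℝ × ℝ → ℂ) (n : ℤ), IsLogOn f h A ∧ IsLogOn f k B ∧ h x = k x ∧
      h y = k y + n * (2 * Real.pi * Complex.I) := by
  obtain ⟨h, hh⟩ := hA
  obtain ⟨k, hk⟩ := hB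
  obtain ⟨k', hk', hkx⟩ := hh.exists_eq_at hk hx
  have : Complex.exp (h y) = Complex.exp (k' y) := by rw [hh.2 y hy.1, hk'.2 y hy.2]
  obtain ⟨n, hn⟩ := Complex.exp_eq_exp_iff_exists_int.1 this
  exact ⟨h, k', n, hh, hk', hkx.symm, hn⟩

namespace PlaneGraph

variable {G : PlaneGraph} {a b c : ℝ × ℝ}

lemma isCompact_arc (h : G.Adj a b) : IsCompact (G.arc a b) := by
  obtain ⟨γ, -, hr⟩ := G.arc_path a b h
  rw [hr]; exact isCompact_range γ.continuous

lemma left_mem_arc (h : G.Adj a b) : a ∈ G.arc a b := by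
  obtain ⟨γ, -, hr⟩ := G.arc_path a b h
  rw [hr]; exact ⟨0, γ.source⟩

lemma right_mem_arc (h : G.Adj a b) : b ∈ G.arc a b := by
  rw [G.arc_symm]; exact left_mem_arc (G.adj_symm _ _ h)

lemma adj_mem_right (h : G.Adj a b) : b ∈ G.verts := G.adj_mem _ _ (G.adj_symm _ _ h)

lemma interior_arc (h : G.Adj a b) : interior (G.arc a b) = ∅ := by
  obtain ⟨γ, hi, hr⟩ := G.arc_path a b h
  rw [hr]; exact interior_range_path_eq_empty γ hi

lemma isPreconnected_arc (h : G.Adj a b) : IsPreconnected (G.arc a b) := by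
  obtain ⟨γ, -, hr⟩ := G.arc_path a b h
  rw [hr]; exact isPreconnected_range γ.continuous

lemma isPreconnected_arc_sdiff (h : G.Adj a b) : IsPreconnected (G.arc a b \ {b}) := by
  obtain ⟨γ, hi, hr⟩ := G.arc_path a b h
  have : G.arc a b \ {b} = γ '' {1}ᶜ := by
    rw [hr, image_compl_eq_range_sdiff_image hi, image_singleton, γ.target]
  rw [this]
  refine IsPreconnected.image ?_ _ γ.continuous.continuousOn
  have : ({1}ᶜ : Set unitInterval) = Iio 1 := by
    ext t; simp [lt_iff_le_and_ne, unitInterval.le_one']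
  rw [this]
  exact isPreconnected_Iio

lemma exists_mem_arc_ne (h : G.Adj a b) : ∃ q ∈ G.arc a b, q ≠ a ∧ q ≠ b := by
  obtain ⟨γ, hi, hr⟩ := G.arc_path a b h
  let t : unitInterval := ⟨1 / 2, by norm_num, by norm_num⟩
  refine ⟨γ t, hr ▸ mem_range_self t, fun ht => ?_, fun ht => ?_⟩
  · have := congrArg Subtype.val (hi (ht.trans γ.source.symm))
    norm_num [t] at this
  · have := congrArg Subtype.val (hi (ht.trans γ.target.symm))
    norm_num [t] at this

lemma exists_isLogOn_arc (h : G.Adj a b) {p : ℝ × ℝ} (hp : p ∉ G.arc a b) :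
    ∃ l, IsLogOn (fun z => planeCoord z - planeCoord p) l (G.arc a b) := by
  obtain ⟨γ, hi, hr⟩ := G.arc_path a b h
  rw [hr] at hp ⊢
  exact exists_isLogOn_range_path γ hi
    (continuous_planeCoord.sub continuous_const).continuousOn
    fun z hz => planeCoord_sub_ne_zero fun he => hp (he ▸ hz)

lemma arc_inter_arc (hab : G.Adj a b) (hbc : G.Adj b c) (hac : a ≠ c) :
    G.arc a b ∩ G.arc b c = {b} := by
  have hb : b ≠ c := fun h => G.adj_irrefl c (h ▸ hbc)
  have hb' : a ≠ b := fun h => G.adj_irrefl b (h ▸ hab)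
  apply Subset.antisymm
  · intro z hz
    have := G.arc_inter a b b c hab hbc (fun he => by
      have : a ∈ ({b, c} : Set (ℝ × ℝ)) := he ▸ mem_insert a {b}
      simp [hac, hb'] at this) hz
    simp only [mem_inter_iff, mem_insert_iff, mem_singleton_iff] at this ⊢
    grind
  · rintro _ rfl
    exact ⟨right_mem_arc hab, left_mem_arc hbc⟩

lemma IsTriangle.symm_left (h : G.IsTriangle a b c) : G.IsTriangle b a c :=
  ⟨h.1.symm, h.2.2.1, h.2.1, G.adj_symm _ _ h.2.2.2.1, h.2.2.2.2.2, h.2.2.2.2.1⟩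

lemma IsTriangle.symm_right (h : G.IsTriangle a b c) : G.IsTriangle a c b :=
  ⟨h.2.1, h.1, h.2.2.1.symm, h.2.2.2.2.2, G.adj_symm _ _ h.2.2.2.2.1, h.2.2.2.1⟩

lemma triDrawing_symm_left (G : PlaneGraph) (a b c : ℝ × ℝ) :
    G.triDrawing b a c = G.triDrawing a b c := by
  simp only [triDrawing, G.arc_symm b a]
  rw [union_assoc, union_comm (G.arc a c), ← union_assoc]

lemma triDrawing_symm_right (G : PlaneGraph) (a b c : ℝ × ℝ) :
    G.triDrawing a c b = G.triDrawing a b c := by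
  simp only [triDrawing, G.arc_symm c b]
  rw [union_assoc, union_comm, union_comm (G.arc b c)]

lemma IsTriangle.two_arcs_inter (h : G.IsTriangle a b c) :
    (G.arc a b ∪ G.arc b c) ∩ G.arc a c = {a, c} := by
  obtain ⟨hab', hac', hbc', hab, hbc, hac⟩ := h
  have h1 := arc_inter_arc (G.adj_symm _ _ hab) hac hbc'
  have h2 := arc_inter_arc hbc (G.adj_symm _ _ hac) hab'.symm
  rw [G.arc_symm b a] at h1
  rw [G.arc_symm c a] at h2
  rw [union_inter_distrib_right, h1, h2]; rfl

lemma IsTriangle.isClosed_two_arcs (h : G.IsTriangle a b c) :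
    IsClosed (G.arc a b ∪ G.arc b c) :=
  (isCompact_arc h.2.2.2.1).isClosed.union (isCompact_arc h.2.2.2.2.1).isClosed

lemma IsTriangle.isClosed_triDrawing (h : G.IsTriangle a b c) :
    IsClosed (G.triDrawing a b c) :=
  h.isClosed_two_arcs.union (isCompact_arc h.2.2.2.2.2).isClosed

lemma IsTriangle.exists_isLogOn_two_arcs (h : G.IsTriangle a b c) {p : ℝ × ℝ}
    (hp : p ∉ G.arc a b ∪ G.arc b c) :
    ∃ l, IsLogOn (fun z => planeCoord z - planeCoord p) l (G.arc a b ∪ G.arc b c) := by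
  obtain ⟨hab', hac', hbc', hab, hbc, hac⟩ := h
  obtain ⟨k, hk⟩ := exists_isLogOn_arc hab fun h => hp (Or.inl h)
  obtain ⟨l, hl⟩ := exists_isLogOn_arc hbc fun h => hp (Or.inr h)
  have hinter := arc_inter_arc hab hbc hac'
  obtain ⟨l', hl', heq⟩ := hk.exists_eq_at hl (x := b) (hinter ▸ mem_singleton b)
  refine hk.union (isCompact_arc hab).isClosed (isCompact_arc hbc).isClosed hl' ?_
  rw [hinter]
  rintro _ rfl
  exact heq.symm

/-- At most one bounded region has a given triangle as its frontier. -/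
lemma IsTriangle.not_disjoint_of_frontier_eq (h : G.IsTriangle a b c) {F₁ F₂ : Set (ℝ × ℝ)}
    (ho₁ : IsOpen F₁) (ho₂ : IsOpen F₂) (hb₁ : Bornology.IsBounded F₁)
    (hb₂ : Bornology.IsBounded F₂) (hn₁ : F₁.Nonempty) (hn₂ : F₂.Nonempty)
    (hf₁ : frontier F₁ = G.triDrawing a b c) (hf₂ : frontier F₂ = G.triDrawing a b c) :
    ¬ Disjoint F₁ F₂ := by
  intro hd
  obtain ⟨p, hp⟩ := hn₁
  obtain ⟨q, hq⟩ := hn₂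
  have hpT : p ∉ G.triDrawing a b c := by
    rw [← hf₁, ho₁.frontier_eq]; exact fun h => h.2 hp
  have hqT : q ∉ G.triDrawing a b c := by
    rw [← hf₂, ho₂.frontier_eq]; exact fun h => h.2 hq
  have hinter := h.two_arcs_inter
  have hac := h.2.2.2.2.2
  have ha : a ∈ (G.arc a b ∪ G.arc b c) ∩ G.arc a c := by simp [hinter]
  have hc : c ∈ (G.arc a b ∪ G.arc b c) ∩ G.arc a c := by simp [hinter]
  obtain ⟨h₁, k₁, n₁, hh₁, hk₁, hx₁, hy₁⟩ := exists_isLogOn_gap ha hc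
    (h.exists_isLogOn_two_arcs fun hm => hpT (Or.inl hm))
    (exists_isLogOn_arc hac fun hm => hpT (Or.inr hm))
  obtain ⟨h₂, k₂, n₂, hh₂, hk₂, hx₂, hy₂⟩ := exists_isLogOn_gap ha hc
    (h.exists_isLogOn_two_arcs fun hm => hqT (Or.inl hm))
    (exists_isLogOn_arc hac fun hm => hqT (Or.inr hm))
  have hcl := h.isClosed_two_arcs
  have hcl' := (isCompact_arc hac).isClosed
  have hqF : ∀ z ∈ closure F₁, planeCoord z - planeCoord q ≠ 0 := fun z hz =>
    planeCoord_sub_ne_zero fun he =>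
      (hd.closure_left ho₂).le_bot ⟨he ▸ hz, hq⟩
  obtain ⟨l, hl⟩ := ((hh₁.zpow n₂).mul (hh₂.zpow (-n₁))).union hcl hcl'
    ((hk₁.zpow n₂).mul (hk₂.zpow (-n₁))) (by
      rw [hinter]
      rintro z (rfl | rfl)
      · simp only [hx₁, hx₂]
      · simp only [hy₁, hy₂]; push_cast; ring)
  change IsLogOn _ l (G.triDrawing a b c) at hl
  rw [← hf₁] at hl
  have hn₂ : n₂ = 0 := eq_zero_of_isLogOn_frontier ho₁ hb₁ hp
    (g := fun z => (planeCoord z - planeCoord q) ^ (-n₁))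
    (ContinuousOn.zpow₀ (continuous_planeCoord.sub continuous_const).continuousOn _
      fun z hz => Or.inl (hqF z hz))
    (fun z hz => zpow_ne_zero _ (hqF z hz)) hl
  obtain ⟨l, hl⟩ := hh₂.union hcl hcl' hk₂ (by
    rw [hinter]
    rintro z (rfl | rfl)
    · exact hx₂
    · simp [hy₂, hn₂])
  exact one_ne_zero (eq_zero_of_isLogOn_frontier ho₂ hb₂ hq (m := 1) (g := fun _ => 1)
    continuousOn_const (fun _ _ => one_ne_zero)
    (by simpa only [hf₂, zpow_one, mul_one, triDrawing] using hl))

/-- A bounded region whose frontier is a triangle cannot lie on both sides of a whole edge. -/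
lemma IsTriangle.exists_closure_notMem_nhds (h : G.IsTriangle a b c) {F : Set (ℝ × ℝ)}
    (ho : IsOpen F) (hb : Bornology.IsBounded F) (hn : F.Nonempty)
    (hf : frontier F = G.triDrawing a b c) :
    ∃ q ∈ G.arc a c, q ≠ a ∧ q ≠ c ∧ closure F ∉ nhds q := by
  by_contra! hcon
  obtain ⟨p, hp⟩ := hn
  set A := G.arc a b ∪ G.arc b c
  have hAcl : IsClosed A := h.isClosed_two_arcs
  have hT : G.triDrawing a b c = A ∪ G.arc a c := rfl
  have hclF : closure F = F ∪ (A ∪ G.arc a c) := by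
    rw [← hT, ← hf, ho.frontier_eq, union_sdiff_cancel subset_closure]
  have hFA : ∀ z ∈ F, z ∉ A := fun z hz hzA => by
    have : z ∈ frontier F := by rw [hf, hT]; exact Or.inl hzA
    rw [ho.frontier_eq] at this
    exact this.2 hz
  set S := closure F \ A
  have hSo : IsOpen S := by
    rw [isOpen_iff_mem_nhds]
    rintro z ⟨hz, hzA⟩
    refine Filter.inter_mem ?_ (hAcl.isOpen_compl.mem_nhds hzA)
    rw [hclF] at hz
    rcases hz with hz | hz | hz
    · exact Filter.mem_of_superset (ho.mem_nhds hz) subset_closure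
    · exact absurd hz hzA
    · refine hcon z hz ?_ ?_
      · rintro rfl; exact hzA (Or.inl (left_mem_arc h.2.2.2.1))
      · rintro rfl; exact hzA (Or.inr (right_mem_arc h.2.2.2.2.1))
  have hpS : p ∈ S := ⟨subset_closure hp, hFA p hp⟩
  have hfr : frontier S ⊆ A := by
    rw [hSo.frontier_eq]
    rintro z ⟨hz, hzS⟩
    by_contra hzA
    exact hzS ⟨closure_minimal sdiff_subset isClosed_closure hz, hzA⟩
  obtain ⟨l, hl⟩ := h.exists_isLogOn_two_arcs (hFA p hp)
  exact one_ne_zero (eq_zero_of_isLogOn_frontier hSo (hb.closure.subset sdiff_subset) hpS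
    (m := 1) (g := fun _ => 1) continuousOn_const (fun _ _ => one_ne_zero)
    (by simpa only [zpow_one, mul_one] using hl.mono hfr))

lemma drawing_eq (G : PlaneGraph) :
    G.drawing = G.verts ∪ ⋃ e ∈ {e : (ℝ × ℝ) × (ℝ × ℝ) | G.Adj e.1 e.2}, G.arc e.1 e.2 := by
  ext z
  simp [drawing]

lemma finite_adj (G : PlaneGraph) : {e : (ℝ × ℝ) × (ℝ × ℝ) | G.Adj e.1 e.2}.Finite :=
  (G.finite_verts.prod G.finite_verts).subset fun _ he => ⟨G.adj_mem _ _ he, adj_mem_right he⟩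

lemma arc_subset_drawing (h : G.Adj a b) : G.arc a b ⊆ G.drawing := fun z hz => by
  rw [drawing_eq]
  exact Or.inr (mem_biUnion (x := (a, b)) h hz)

lemma IsTriangle.triDrawing_subset_drawing (h : G.IsTriangle a b c) :
    G.triDrawing a b c ⊆ G.drawing :=
  union_subset (union_subset (arc_subset_drawing h.2.2.2.1) (arc_subset_drawing h.2.2.2.2.1))
    (arc_subset_drawing h.2.2.2.2.2)

lemma isClosed_drawing (G : PlaneGraph) : IsClosed G.drawing := by
  rw [drawing_eq]
  exact G.finite_verts.isClosed.union
    (G.finite_adj.isClosed_biUnion fun e he => (isCompact_arc he).isClosed)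

lemma dense_compl_drawing (G : PlaneGraph) : Dense G.drawingᶜ := by
  rw [drawing_eq, compl_union, compl_iUnion₂]
  refine Dense.inter_of_isOpen_left (G.finite_verts.countable.dense_compl ℝ) ?_
    G.finite_verts.isClosed.isOpen_compl
  exact dense_biInter_of_isOpen (fun e he => (isCompact_arc he).isClosed.isOpen_compl)
    G.finite_adj.countable fun e he => interior_eq_empty_iff_dense_compl.1 (interior_arc he)

lemma IsFace.isOpen {F : Set (ℝ × ℝ)} (h : G.IsFace F) : IsOpen F := by
  obtain ⟨x, -, rfl⟩ := h
  exact G.isClosed_drawing.isOpen_compl.connectedComponentIn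

lemma IsFace.isPreconnected {F : Set (ℝ × ℝ)} (h : G.IsFace F) : IsPreconnected F := by
  obtain ⟨x, -, rfl⟩ := h
  exact isPreconnected_connectedComponentIn

lemma IsFace.nonempty {F : Set (ℝ × ℝ)} (h : G.IsFace F) : F.Nonempty := by
  obtain ⟨x, hx, rfl⟩ := h
  exact ⟨x, mem_connectedComponentIn hx⟩

lemma IsFace.subset {F : Set (ℝ × ℝ)} (h : G.IsFace F) : F ⊆ G.drawingᶜ := by
  obtain ⟨x, -, rfl⟩ := h
  exact connectedComponentIn_subset _ _

lemma IsFace.eq_of_not_disjoint {F F' : Set (ℝ × ℝ)} (h : G.IsFace F) (h' : G.IsFace F')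
    (hd : ¬ Disjoint F F') : F = F' := by
  obtain ⟨x, -, rfl⟩ := h
  obtain ⟨y, -, rfl⟩ := h'
  obtain ⟨z, hz, hz'⟩ := not_disjoint_iff.1 hd
  rw [connectedComponentIn_eq hz, connectedComponentIn_eq hz']

lemma isFace_of_notMem {x : ℝ × ℝ} (hx : x ∉ G.drawing) :
    G.IsFace (connectedComponentIn G.drawingᶜ x) := ⟨x, hx, rfl⟩

/-- Bounded faces are determined by the triangle bounding them. -/
lemma IsTriangle.face_unique (h : G.IsTriangle a b c) {F F' : Set (ℝ × ℝ)}
    (hF : G.IsFace F) (hF' : G.IsFace F') (hb : Bornology.IsBounded F)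
    (hb' : Bornology.IsBounded F') (hf : frontier F = G.triDrawing a b c)
    (hf' : frontier F' = G.triDrawing a b c) : F = F' :=
  hF.eq_of_not_disjoint hF' (h.not_disjoint_of_frontier_eq hF.isOpen hF'.isOpen hb hb'
    hF.nonempty hF'.nonempty hf hf')

lemma IsWNT.finite_bounded_faces (hG : G.IsWNT) :
    {F | G.IsFace F ∧ Bornology.IsBounded F}.Finite := by
  have hfin := G.finite_verts.prod (G.finite_verts.prod G.finite_verts)
  refine (hfin.biUnion (t := fun t => {F | G.IsFace F ∧ Bornology.IsBounded F ∧
    G.IsTriangle t.1 t.2.1 t.2.2 ∧ frontier F = G.triDrawing t.1 t.2.1 t.2.2})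
    fun t _ => Subsingleton.finite ?_).subset ?_
  · rintro F ⟨hF, hb, ht, hf⟩ F' ⟨hF', hb', -, hf'⟩
    exact ht.face_unique hF hF' hb hb' hf hf'
  · rintro F ⟨hF, hb⟩
    obtain ⟨a, b, c, ht, hf⟩ := hG.1 F hF hb
    exact mem_biUnion (x := (a, b, c)) ⟨G.adj_mem _ _ ht.2.2.2.1, adj_mem_right ht.2.2.2.1,
      adj_mem_right ht.2.2.2.2.1⟩ ⟨hF, hb, ht, hf⟩

/-- A triangle whose drawing contains an inner point of an edge contains that edge. -/
lemma IsTriangle.exists_eq_of_mem_arc (h : G.IsTriangle a b c) {x y q : ℝ × ℝ}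
    (hxy : G.Adj x y) (hq : q ∈ G.arc x y) (hqx : q ≠ x) (hqy : q ≠ y)
    (hqT : q ∈ G.triDrawing a b c) :
    ∃ z, G.IsTriangle x z y ∧ G.triDrawing x z y = G.triDrawing a b c := by
  have key : ∀ a b c, G.IsTriangle a b c → q ∈ G.arc a b →
      ∃ z, G.IsTriangle x z y ∧ G.triDrawing x z y = G.triDrawing a b c := by
    intro a b c h hab
    have heq : ({x, y} : Set (ℝ × ℝ)) = {a, b} := by
      by_contra hne
      have := (G.arc_inter x y a b hxy h.2.2.2.1 hne ⟨hq, hab⟩).1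
      simp [hqx, hqy] at this
    rcases pair_eq_pair_iff.1 heq with ⟨rfl, rfl⟩ | ⟨rfl, rfl⟩
    · exact ⟨c, h.symm_right, G.triDrawing_symm_right _ _ _⟩
    · exact ⟨c, h.symm_left.symm_right,
        (G.triDrawing_symm_right _ _ _).trans (G.triDrawing_symm_left _ _ _)⟩
  rcases hqT with (h1 | h1) | h1
  · exact key _ _ _ h h1
  · obtain ⟨z, hz, he⟩ := key _ _ _ h.symm_left.symm_right h1
    exact ⟨z, hz, he.trans ((G.triDrawing_symm_right _ _ _).trans (G.triDrawing_symm_left _ _ _))⟩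
  · obtain ⟨z, hz, he⟩ := key _ _ _ h.symm_right h1
    exact ⟨z, hz, he.trans (G.triDrawing_symm_right _ _ _)⟩

/-- An edge starting at a vertex off a triangle meets the triangle at most at its other end. -/
lemma IsTriangle.arc_inter_triDrawing_subset (h : G.IsTriangle a b c) {x z : ℝ × ℝ}
    (hxz : G.Adj x z) (hx : x ∉ G.triDrawing a b c) :
    G.arc x z ∩ G.triDrawing a b c ⊆ {z} := by
  have key : ∀ d e, G.Adj d e → x ∉ G.arc d e → ∀ r ∈ G.arc x z, r ∈ G.arc d e → r = z := by
    intro d e hde hxde r hr hr'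
    have hne : ({x, z} : Set (ℝ × ℝ)) ≠ {d, e} := by
      intro heq
      have : x ∈ ({d, e} : Set (ℝ × ℝ)) := heq ▸ mem_insert x {z}
      rcases this with rfl | rfl
      · exact hxde (left_mem_arc hde)
      · exact hxde (right_mem_arc hde)
    rcases (G.arc_inter x z d e hxz hde hne ⟨hr, hr'⟩).1 with rfl | h
    · exact absurd hr' hxde
    · exact h
  rintro r ⟨hr, (hr' | hr') | hr'⟩
  · exact key _ _ h.2.2.2.1 (fun h' => hx (Or.inl (Or.inl h'))) r hr hr'
  · exact key _ _ h.2.2.2.2.1 (fun h' => hx (Or.inl (Or.inr h'))) r hr hr'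
  · exact key _ _ h.2.2.2.2.2 (fun h' => hx (Or.inr h')) r hr hr'

/-- A vertex lying on a triangle is one of its three vertices. -/
lemma IsTriangle.eq_of_mem_triDrawing (h : G.IsTriangle a b c) {z : ℝ × ℝ} (hz : z ∈ G.verts)
    (hzT : z ∈ G.triDrawing a b c) : z = a ∨ z = b ∨ z = c := by
  rcases hzT with (h1 | h1) | h1
  · have := G.arc_verts _ _ h.2.2.2.1 ⟨hz, h1⟩
    simp only [mem_insert_iff, mem_singleton_iff] at this; tauto
  · have := G.arc_verts _ _ h.2.2.2.2.1 ⟨hz, h1⟩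
    simp only [mem_insert_iff, mem_singleton_iff] at this; tauto
  · have := G.arc_verts _ _ h.2.2.2.2.2 ⟨hz, h1⟩
    simp only [mem_insert_iff, mem_singleton_iff] at this; tauto

lemma IsTriangle.isOpen_triangleInterior (h : G.IsTriangle a b c) :
    IsOpen (G.triangleInterior a b c) := by
  rw [isOpen_iff_mem_nhds]
  rintro z ⟨hz, hzb⟩
  have hop := h.isClosed_triDrawing.isOpen_compl.connectedComponentIn (x := z)
  filter_upwards [hop.mem_nhds (mem_connectedComponentIn hz)] with r hr
  exact ⟨connectedComponentIn_subset _ _ hr, connectedComponentIn_eq hr ▸ hzb⟩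

/-- A connected set that avoids a triangle and meets its interior lies in its interior. -/
lemma subset_triangleInterior {S : Set (ℝ × ℝ)} (hS : IsPreconnected S)
    (hd : S ⊆ (G.triDrawing a b c)ᶜ) {p : ℝ × ℝ} (hp : p ∈ S)
    (hpT : p ∈ G.triangleInterior a b c) :
    S ⊆ G.triangleInterior a b c ∧ Bornology.IsBounded S := by
  have hsub := hS.subset_connectedComponentIn hp hd
  exact ⟨fun r hr => ⟨hd hr, connectedComponentIn_eq (hsub hr) ▸ hpT.2⟩, hpT.2.subset hsub⟩

/-- A neighbour of a vertex inside a triangle is inside the triangle or on it. -/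
lemma IsTriangle.neighbor_mem (h : G.IsTriangle a b c) {x z : ℝ × ℝ}
    (hx : x ∈ G.triangleInterior a b c) (hxz : G.Adj x z) :
    z ∈ G.triangleInterior a b c ∨ z = a ∨ z = b ∨ z = c := by
  by_cases hz : z ∈ G.triDrawing a b c
  · exact Or.inr (h.eq_of_mem_triDrawing (adj_mem_right hxz) hz)
  · refine Or.inl ((subset_triangleInterior (isPreconnected_arc hxz) (fun r hr hrT => ?_)
      (left_mem_arc hxz) hx).1 (right_mem_arc hxz))
    rw [h.arc_inter_triDrawing_subset hxz hx.1 ⟨hr, hrT⟩] at hrT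
    exact hz hrT

lemma IsTriangle.arc_sdiff_subset_interior (h : G.IsTriangle a b c) {x z : ℝ × ℝ}
    (hx : x ∈ G.triangleInterior a b c) (hxz : G.Adj x z) :
    G.arc x z \ {z} ⊆ G.triangleInterior a b c :=
  (subset_triangleInterior (isPreconnected_arc_sdiff hxz)
    (fun _ hr hrT => hr.2 (h.arc_inter_triDrawing_subset hxz hx.1 ⟨hr.1, hrT⟩))
    ⟨left_mem_arc hxz, fun he => G.adj_irrefl x (by
      rw [mem_singleton_iff] at he; rwa [← he] at hxz)⟩ hx).1

/-- Faces incident to a point inside a triangle are bounded. -/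
lemma IsTriangle.isBounded_face (h : G.IsTriangle a b c) {F : Set (ℝ × ℝ)} (hF : G.IsFace F)
    {q : ℝ × ℝ} (hq : q ∈ G.triangleInterior a b c) (hqF : q ∈ closure F) :
    Bornology.IsBounded F := by
  obtain ⟨r, hr, hrF⟩ := mem_closure_iff.1 hqF _ h.isOpen_triangleInterior hq
  exact (subset_triangleInterior hF.isPreconnected
    (hF.subset.trans (compl_subset_compl.2 h.triDrawing_subset_drawing)) hrF hr).2

/-- If every face incident to a point inside a triangle is `F`, then the closure of `F` is a
neighbourhood of the point. -/
lemma IsWNT.closure_mem_nhds (hG : G.IsWNT) (h : G.IsTriangle a b c) {F : Set (ℝ × ℝ)}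
    {q : ℝ × ℝ} (hq : q ∈ G.triangleInterior a b c)
    (huniq : ∀ F', G.IsFace F' → q ∈ closure F' → F' = F) : closure F ∈ nhds q := by
  let N := G.triangleInterior a b c \
    ⋃ F' ∈ {F' | (G.IsFace F' ∧ Bornology.IsBounded F') ∧ q ∉ closure F'}, closure F'
  have hNo : IsOpen N := h.isOpen_triangleInterior.sdiff
    ((hG.finite_bounded_faces.subset fun _ h => h.1).isClosed_biUnion fun _ _ => isClosed_closure)
  have hqN : q ∈ N := ⟨hq, by simp⟩
  have hsub : N ∩ G.drawingᶜ ⊆ F := by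
    rintro r ⟨⟨hrI, hr⟩, hrd⟩
    have hF' := isFace_of_notMem hrd
    have hrF' := mem_connectedComponentIn hrd
    have hb := h.isBounded_face hF' hrI (subset_closure hrF')
    have hqF' : q ∈ closure (connectedComponentIn G.drawingᶜ r) := by
      by_contra hcon
      exact hr (mem_biUnion (x := connectedComponentIn G.drawingᶜ r) ⟨⟨hF', hb⟩, hcon⟩
        (subset_closure hrF'))
    rw [← huniq _ hF' hqF']
    exact hrF'
  exact Filter.mem_of_superset (hNo.mem_nhds hqN)
    ((G.dense_compl_drawing.open_subset_closure_inter hNo).trans (closure_mono hsub))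

/-- Some face is incident to any given point inside a triangle. -/
lemma IsWNT.exists_face (hG : G.IsWNT) (h : G.IsTriangle a b c) {q : ℝ × ℝ}
    (hq : q ∈ G.triangleInterior a b c) : ∃ F, G.IsFace F ∧ q ∈ closure F := by
  by_contra! hcon
  have := mem_of_mem_nhds (hG.closure_mem_nhds (F := ∅) h hq
    fun F' hF' hq' => absurd hq' (hcon F' hF'))
  simp at this

/-- In a weak near-triangulation, an edge with an end inside a triangle is on the boundary of two
faces, and thus in two triangles. -/
lemma IsWNT.exists_second_triangle (hG : G.IsWNT) (h : G.IsTriangle a b c) {x y z : ℝ × ℝ}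
    (hx : x ∈ G.triangleInterior a b c) (hxyz : G.IsTriangle x y z) :
    ∃ t, t ≠ y ∧ G.IsTriangle x t z := by
  by_contra! hcon
  have hxz := hxyz.2.2.2.2.2
  have hin : ∀ q ∈ G.arc x z, q ≠ z → q ∈ G.triangleInterior a b c := fun q hq hqz =>
    h.arc_sdiff_subset_interior hx hxz ⟨hq, hqz⟩
  have hfr : ∀ q ∈ G.arc x z, q ≠ x → q ≠ z → ∀ F, G.IsFace F → q ∈ closure F →
      Bornology.IsBounded F ∧ frontier F = G.triDrawing x y z := by
    intro q hq hqx hqz F hF hqF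
    have hb := h.isBounded_face hF (hin q hq hqz) hqF
    obtain ⟨d, e, f, ht, hf⟩ := hG.1 F hF hb
    have hqf : q ∈ G.triDrawing d e f := by
      rw [← hf, hF.isOpen.frontier_eq]
      exact ⟨hqF, fun h => hF.subset h (arc_subset_drawing hxz hq)⟩
    obtain ⟨t, ht', he⟩ := ht.exists_eq_of_mem_arc hxz hq hqx hqz hqf
    obtain rfl : t = y := by_contra fun hty => hcon t hty ht'
    exact ⟨hb, hf.trans he.symm⟩
  obtain ⟨q₀, hq₀, hq₀x, hq₀z⟩ := exists_mem_arc_ne hxz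
  obtain ⟨F, hF, hqF⟩ := hG.exists_face h (hin q₀ hq₀ hq₀z)
  obtain ⟨hb, hf⟩ := hfr q₀ hq₀ hq₀x hq₀z F hF hqF
  obtain ⟨q, hq, hqx, hqz, hqn⟩ := hxyz.exists_closure_notMem_nhds hF.isOpen hb hF.nonempty hf
  refine hqn (hG.closure_mem_nhds h (hin q hq hqz) fun F' hF' hq' => ?_)
  obtain ⟨hb', hf'⟩ := hfr q hq hqx hqz F' hF' hq'
  exact hxyz.face_unique hF' hF hb' hb hf' hf

end PlaneGraph

open PlaneGraph in
/-- Let `G` be a weak near-triangulation and `X ⊆ V(G)` with `G − X` a weak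
near-triangulation. Suppose `uvw` is a triangle of `G`, `Y` is the set of vertices of
`G` in the interior of `uvw`, `X ∩ Y = ∅`, `u ∈ X` and `v, w ∉ X`. If `y ∈ Y` is
problematic in `G − X`, then every `y`-bad vertex in `G − X` is adjacent to `u` in `G`. -/
theorem WNT_bad_vertices_in_triangle (G : PlaneGraph) (hG : G.IsWNT)
    (X : Set (ℝ × ℝ)) (hX : X ⊆ G.verts) (h1 : (G.delete X).IsWNT)
    (u v w : ℝ × ℝ) (htri : G.IsTriangle u v w)
    (Y : Set (ℝ × ℝ)) (hY : Y = G.verts ∩ G.triangleInterior u v w)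
    (hXY : X ∩ Y = ∅) (huX : u ∈ X) (hvX : v ∉ X) (hwX : w ∉ X)
    (y : ℝ × ℝ) (hy : y ∈ Y) (hprob : (G.delete X).Problematic y) :
    ∀ x, (G.delete X).IsBadFor y x → G.Adj u x := by
  rintro x ⟨⟨hxG, hxX⟩, hxy, hbad⟩
  by_contra hux
  have hbad' : ∀ b c, G.IsTriangle x b c → b ∉ X → c ∉ X → b = y ∨ c = y := by
    intro b c ht hb hc
    by_contra! hne
    obtain ⟨h1, h2, h3, hxb, hbc, hxc⟩ := ht
    exact hbad ⟨b, c, h1, h2, h3, ⟨⟨hxb, hxX, hb⟩, hxy, hne.1⟩, ⟨⟨hbc, hb, hc⟩, hne.1, hne.2⟩,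
      ⟨⟨hxc, hxX, hc⟩, hxy, hne.2⟩⟩
  obtain ⟨z, hxyz⟩ : ∃ z, G.IsTriangle x y z := by
    obtain ⟨b, c, h1, h2, h3, hb, hc, hd⟩ := h1.2 x ⟨hxG, hxX⟩
    have ht : G.IsTriangle x b c := ⟨h1, h2, h3, hb.1, hc.1, hd.1⟩
    rcases hbad' b c ht hb.2.2 hc.2.2 with rfl | rfl
    · exact ⟨c, ht⟩
    · exact ⟨b, ht.symm_right⟩
  have hyI : y ∈ G.triangleInterior u v w := by rw [hY] at hy; exact hy.2
  have hxI : x ∈ G.triangleInterior u v w := by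
    rcases htri.neighbor_mem hyI (G.adj_symm _ _ hxyz.2.2.2.1) with h | rfl | rfl | rfl
    · exact h
    · exact absurd huX hxX
    · exact absurd htri.2.2.2.1 hux
    · exact absurd htri.2.2.2.2.2 hux
  have hnX : ∀ t, G.Adj x t → t ∉ X := by
    intro t ht htX
    rcases htri.neighbor_mem hxI ht with h | rfl | rfl | rfl
    · exact (hXY ▸ ⟨htX, hY ▸ ⟨adj_mem_right ht, h⟩⟩ : t ∈ (∅ : Set (ℝ × ℝ)))
    · exact hux (G.adj_symm _ _ ht)
    · exact hvX htX
    · exact hwX htX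
  obtain ⟨t, hty, hxtz⟩ := hG.exists_second_triangle htri hxI hxyz
  rcases hbad' t z hxtz (hnX t hxtz.2.2.2.1) (hnX z hxtz.2.2.2.2.2) with h | h
  · exact hty h
  · exact hxyz.2.2.1 h.symm
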